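/- arXiv:2510.10554 — 2 statements merged into one kernel-verified Lean document; each statement's English description precedes it below -/
import Mathlib

section
/- Let k ≥ 3 be an integer and let x ∈ ℂ with Re(x) > 0. Then, as (α, β) → (0, 0) through points of (ℝ∖ℤ) × (ℝ∖ℤ), the expression −𝓕_k(x; α, β) − (γ + Log(1 − e^{2πiβ})) · Li_{k−1}(e^{2πiα}) converges to 𝓕_k(x) := Σ_{n=1}^∞ ψ(nx)/n^{k−1}, where the series defining 𝓕_k(x) converges absolutely. -/
open Complex MeasureTheory Filter Topology Set Asymptotics

noncomputable section

/-- `e2pi θ = e^{2πiθ}`. -/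
def e2pi (θ : ℝ) : ℂ := Complex.exp (2 * Real.pi * Complex.I * θ)

/-- Polylogarithm of integer order: `Li 0 z = z/(1-z)`, `Li 1 z = -Log(1-z)`,
`Li m z = ∑_{n≥1} z^n/n^m` for `m ≥ 2`. -/
def Li : ℕ → ℂ → ℂ
  | 0, z => z / (1 - z)
  | 1, z => -Complex.log (1 - z)
  | (m+2), z => ∑' n : ℕ, z ^ (n+1) / ((n+1 : ℕ) : ℂ) ^ (m+2)

/-- The higher Herglotz–Zagier–Novikov function
`𝓕_k(x; α, β) = ∫₀^∞ Li_{k-1}(e^{-xt} e^{2πiα}) / (1 - e^{-t} e^{2πiβ}) dt`. -/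
def HHZN (k : ℕ) (x : ℂ) (α β : ℝ) : ℂ :=
  ∫ t in Set.Ioi (0:ℝ),
    Li (k-1) (Complex.exp (-x * t) * e2pi α) / (1 - Complex.exp (-(t:ℂ)) * e2pi β)

/-- The digamma function `ψ(z) = Γ'(z)/Γ(z)`. -/
def digamma (z : ℂ) : ℂ := deriv Complex.Gamma z / Complex.Gamma z

/-- The integrand `(b e^{-t} - e^{-zt}) / (1 - e^{-t} b)`; for `b = 1` it is the one in Gauss'
integral for `ψ(z) + γ`. -/
def gaussKernel (z b : ℂ) (t : ℝ) : ℂ :=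
  (b * Complex.exp (-(t : ℂ)) - Complex.exp (-z * t)) / (1 - Complex.exp (-(t : ℂ)) * b)

/-- The integral of `gaussKernel z b` over the positive half-line. -/
def gaussIntegral (z b : ℂ) : ℂ := ∫ t in Ioi (0 : ℝ), gaussKernel z b t

/-- An integrable function of `t` that dominates `gaussKernel z b t`, up to a factor, for
`s ≤ z.re` and `‖b‖ = 1`. -/
def gaussMajorant (s t : ℝ) : ℝ :=
  Real.exp (-t) * t ^ ((1 / 2 : ℝ) - 1) + (Real.exp (-1 * t) + Real.exp (-s * t))

theorem integrableOn_gaussMajorant {s : ℝ} (hs : 0 < s) :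
    IntegrableOn (gaussMajorant s) (Ioi 0) :=
  (Real.GammaIntegral_convergent (by norm_num)).add
    ((exp_neg_integrableOn_Ioi 0 one_pos).add (exp_neg_integrableOn_Ioi 0 hs))

theorem norm_one_sub_exp_neg_le {w : ℂ} (hw : 0 ≤ w.re) :
    ‖1 - Complex.exp (-w)‖ ≤ 2 * √‖w‖ := by
  rcases le_total ‖w‖ 1 with h | h
  · have h1 := Complex.norm_exp_sub_one_le (x := -w) (by simpa using h)
    rw [norm_sub_rev, norm_neg] at h1
    refine h1.trans (mul_le_mul_of_nonneg_left ?_ zero_le_two)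
    exact Real.le_sqrt_of_sq_le (by nlinarith [norm_nonneg w])
  · have h1 : ‖Complex.exp (-w)‖ ≤ 1 := by
      rw [Complex.norm_exp]
      simpa using hw
    have h2 : ‖1 - Complex.exp (-w)‖ ≤ 1 + 1 := by
      refine (norm_sub_le _ _).trans ?_
      simpa using h1
    have h3 : 1 ≤ √‖w‖ := Real.one_le_sqrt.mpr h
    linarith

theorem norm_exp_neg_ofReal (t : ℝ) : ‖Complex.exp (-(t : ℂ))‖ = Real.exp (-t) := by
  simp [Complex.norm_exp]

theorem one_sub_exp_neg_le_norm {b : ℂ} (hb : ‖b‖ = 1) (t : ℝ) :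
    1 - Real.exp (-t) ≤ ‖1 - Complex.exp (-(t : ℂ)) * b‖ := by
  have h := norm_sub_norm_le 1 (Complex.exp (-(t : ℂ)) * b)
  rwa [norm_mul, hb, norm_exp_neg_ofReal, norm_one, mul_one] at h

theorem div_one_add_le_one_sub_exp_neg {t : ℝ} (ht : 0 < t) :
    t / (1 + t) ≤ 1 - Real.exp (-t) := by
  have h1 : Real.exp (-t) ≤ 1 / (1 + t) := by
    rw [Real.exp_neg, ← one_div]
    exact one_div_le_one_div_of_le (by linarith) (by linarith [Real.add_one_le_exp t])
  have h2 : t / (1 + t) = 1 - 1 / (1 + t) := by field_simp; ring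
  linarith

theorem one_sub_exp_neg_mul_ne_zero {b : ℂ} (hb : ‖b‖ = 1) {t : ℝ} (ht : 0 < t) :
    1 - Complex.exp (-(t : ℂ)) * b ≠ 0 := by
  rw [← norm_pos_iff]
  have := one_sub_exp_neg_le_norm hb t
  have := div_one_add_le_one_sub_exp_neg ht
  have : 0 < t / (1 + t) := by positivity
  linarith

theorem norm_gaussKernel_le {z b : ℂ} {s t : ℝ} (hs : 0 < s) (hz : s ≤ z.re) (hb : ‖b‖ = 1)
    (ht : 0 < t) : ‖gaussKernel z b t‖ ≤ 12 * (1 + √‖z‖) * gaussMajorant s t := by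
  have hne := one_sub_exp_neg_mul_ne_zero hb ht
  have hden := one_sub_exp_neg_le_norm hb t
  have hden' := div_one_add_le_one_sub_exp_neg ht
  have hsz : 0 ≤ √‖z‖ := Real.sqrt_nonneg _
  have hp : (0 : ℝ) < t ^ ((1 / 2 : ℝ) - 1) := Real.rpow_pos_of_pos ht _
  have he1 := Real.exp_pos (-t)
  have he2 := Real.exp_pos (-s * t)
  have hE : -1 * t = -t := by ring
  unfold gaussMajorant
  rw [hE]
  rcases le_total t 1 with h1 | h1
  · have hd : t / 2 ≤ ‖1 - Complex.exp (-(t : ℂ)) * b‖ := by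
      have : t / 2 ≤ t / (1 + t) := div_le_div_of_nonneg_left ht.le (by linarith) (by linarith)
      linarith
    have hsplit : gaussKernel z b t
        = -1 + (1 - Complex.exp (-(z * t))) / (1 - Complex.exp (-(t : ℂ)) * b) := by
      unfold gaussKernel
      rw [neg_mul, div_eq_iff hne, add_mul, div_mul_cancel₀ _ hne]
      ring
    have hnum : ‖1 - Complex.exp (-(z * t))‖ ≤ 2 * (√‖z‖ * √t) := by
      have := norm_one_sub_exp_neg_le (w := z * t) (by
        rw [Complex.re_mul_ofReal]; exact mul_nonneg (hs.le.trans hz) ht.le)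
      rwa [norm_mul, Complex.norm_real, Real.norm_of_nonneg ht.le,
        Real.sqrt_mul (norm_nonneg z)] at this
    have hquot : ‖(1 - Complex.exp (-(z * t))) / (1 - Complex.exp (-(t : ℂ)) * b)‖
        ≤ 4 * √‖z‖ * t ^ ((1 / 2 : ℝ) - 1) := by
      rw [norm_div]
      calc _ ≤ 2 * (√‖z‖ * √t) / (t / 2) :=
            div_le_div₀ (by positivity) hnum (by positivity) hd
        _ = _ := by
            rw [Real.rpow_sub_one ht.ne', ← Real.sqrt_eq_rpow]
            field_simp
            ring
    have hexp : 1 ≤ 3 * Real.exp (-t) := by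
      have h3 : Real.exp t ≤ 3 :=
        (Real.exp_le_exp.mpr h1).trans Real.exp_one_lt_three.le
      have : Real.exp t * Real.exp (-t) = 1 := by rw [← Real.exp_add]; simp
      nlinarith
    calc ‖gaussKernel z b t‖ ≤ 1 + 4 * √‖z‖ * t ^ ((1 / 2 : ℝ) - 1) := by
          rw [hsplit]
          refine (norm_add_le _ _).trans ?_
          simpa using hquot
      _ ≤ 3 * Real.exp (-t) + 4 * √‖z‖ * t ^ ((1 / 2 : ℝ) - 1) * (3 * Real.exp (-t)) := by
          have : 0 ≤ 4 * √‖z‖ * t ^ ((1 / 2 : ℝ) - 1) := by positivity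
          nlinarith
      _ ≤ _ := by
          have a1 : 0 ≤ √‖z‖ * Real.exp (-t) := by positivity
          have a2 : 0 ≤ √‖z‖ * Real.exp (-s * t) := by positivity
          have a3 : 0 ≤ Real.exp (-t) * t ^ ((1 / 2 : ℝ) - 1) := by positivity
          nlinarith
  · have hd : 1 / 2 ≤ ‖1 - Complex.exp (-(t : ℂ)) * b‖ := by
      have : 1 / 2 ≤ t / (1 + t) := by
        rw [div_le_div_iff₀ (by norm_num) (by linarith)]
        linarith
      linarith
    have hnum : ‖b * Complex.exp (-(t : ℂ)) - Complex.exp (-z * t)‖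
        ≤ Real.exp (-t) + Real.exp (-s * t) := by
      refine (norm_sub_le _ _).trans ?_
      rw [norm_mul, hb, one_mul, norm_exp_neg_ofReal]
      gcongr
      rw [Complex.norm_exp, Complex.re_mul_ofReal, Complex.neg_re]
      gcongr
    calc ‖gaussKernel z b t‖ ≤ (Real.exp (-t) + Real.exp (-s * t)) / (1 / 2) := by
          unfold gaussKernel
          rw [norm_div]
          exact div_le_div₀ (by positivity) hnum (by norm_num) hd
      _ ≤ _ := by
          have a1 : 0 ≤ √‖z‖ * Real.exp (-t) := by positivity
          have a2 : 0 ≤ √‖z‖ * Real.exp (-s * t) := by positivity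
          have a3 : 0 ≤ Real.exp (-t) * t ^ ((1 / 2 : ℝ) - 1) := by positivity
          nlinarith [mul_nonneg hsz a3]

theorem measurable_gaussKernel (z b : ℂ) : Measurable (gaussKernel z b) := by
  unfold gaussKernel
  fun_prop

theorem integrableOn_gaussKernel {z b : ℂ} (hz : 0 < z.re) (hb : ‖b‖ = 1) :
    IntegrableOn (gaussKernel z b) (Ioi 0) := by
  refine ((integrableOn_gaussMajorant hz).const_mul (12 * (1 + √‖z‖))).mono'
    (measurable_gaussKernel z b).aestronglyMeasurable ?_
  filter_upwards [ae_restrict_mem measurableSet_Ioi] with t ht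
  exact norm_gaussKernel_le hz le_rfl hb ht

theorem norm_gaussIntegral_le {z b : ℂ} {s : ℝ} (hs : 0 < s) (hz : s ≤ z.re) (hb : ‖b‖ = 1) :
    ‖gaussIntegral z b‖ ≤ 12 * (1 + √‖z‖) * ∫ t in Ioi (0 : ℝ), gaussMajorant s t := by
  rw [← integral_const_mul]
  refine norm_integral_le_of_norm_le ((integrableOn_gaussMajorant hs).const_mul _) ?_
  filter_upwards [ae_restrict_mem measurableSet_Ioi] with t ht
  exact norm_gaussKernel_le hs hz hb ht

theorem tendsto_gaussIntegral {ι : Type*} {l : Filter ι} [l.IsCountablyGenerated] {z b₀ : ℂ}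
    {b : ι → ℂ} (hz : 0 < z.re) (hb : ∀ i, ‖b i‖ = 1) (hb₀ : ‖b₀‖ = 1)
    (h : Tendsto b l (𝓝 b₀)) :
    Tendsto (fun i => gaussIntegral z (b i)) l (𝓝 (gaussIntegral z b₀)) := by
  refine tendsto_integral_filter_of_dominated_convergence _
    (Eventually.of_forall fun i => (measurable_gaussKernel z (b i)).aestronglyMeasurable)
    (Eventually.of_forall fun i => ?_)
    ((integrableOn_gaussMajorant hz).const_mul (12 * (1 + √‖z‖))) ?_
  · filter_upwards [ae_restrict_mem measurableSet_Ioi] with t ht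
    exact norm_gaussKernel_le hz le_rfl (hb i) ht
  · filter_upwards [ae_restrict_mem measurableSet_Ioi] with t ht
    exact ((h.mul_const _).sub_const _).div ((h.const_mul _).const_sub _)
      (one_sub_exp_neg_mul_ne_zero hb₀ ht)

theorem gaussIntegral_one_one : gaussIntegral 1 1 = 0 := by
  simp [gaussIntegral, gaussKernel]

theorem gaussIntegral_add_one {z : ℂ} (hz : 0 < z.re) :
    gaussIntegral (z + 1) 1 = gaussIntegral z 1 + 1 / z := by
  have h1 : (0 : ℝ) < (z + 1).re := by simp; linarith
  rw [← sub_eq_iff_eq_add', gaussIntegral, gaussIntegral,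
    ← integral_sub (integrableOn_gaussKernel h1 norm_one) (integrableOn_gaussKernel hz norm_one)]
  have h2 : ∫ t in Ioi (0 : ℝ), (gaussKernel (z + 1) 1 t - gaussKernel z 1 t)
      = ∫ t in Ioi (0 : ℝ), Complex.exp (-z * t) := by
    refine setIntegral_congr_fun measurableSet_Ioi fun t ht => ?_
    have hne := one_sub_exp_neg_mul_ne_zero norm_one ht
    have hexp : Complex.exp (-(z + 1) * t) = Complex.exp (-z * t) * Complex.exp (-(t : ℂ)) := by
      rw [← Complex.exp_add]
      ring_nf
    simp only [gaussKernel, hexp]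
    rw [← sub_div, div_eq_iff hne]
    ring
  rw [h2, integral_exp_mul_complex_Ioi (by simpa using hz)]
  simp

theorem monotoneOn_re_gaussIntegral :
    MonotoneOn (fun y : ℝ => (gaussIntegral y 1).re) (Ioi 0) := by
  intro x hx y hy hxy
  have hx' : 0 < (x : ℂ).re := hx
  have hy' : 0 < (y : ℂ).re := hy
  have h : gaussIntegral y 1 - gaussIntegral x 1 = ((∫ t in Ioi (0 : ℝ),
      (Real.exp (-x * t) - Real.exp (-y * t)) / (1 - Real.exp (-t)) : ℝ) : ℂ) := by
    rw [gaussIntegral, gaussIntegral, ← integral_sub (integrableOn_gaussKernel hy' norm_one)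
      (integrableOn_gaussKernel hx' norm_one), ← integral_complex_ofReal]
    refine integral_congr_ae (Eventually.of_forall fun t => ?_)
    simp only [gaussKernel]
    push_cast
    ring
  have h0 : 0 ≤ ∫ t in Ioi (0 : ℝ),
      (Real.exp (-x * t) - Real.exp (-y * t)) / (1 - Real.exp (-t)) := by
    refine setIntegral_nonneg measurableSet_Ioi fun t ht => ?_
    have ht0 : 0 < t := ht
    refine div_nonneg (sub_nonneg.mpr ?_) (sub_nonneg.mpr ?_)
    · gcongr
    · simpa using ht0.le
  have h' := congrArg Complex.re h
  rw [Complex.sub_re, Complex.ofReal_re] at h'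
  show (gaussIntegral x 1).re ≤ (gaussIntegral y 1).re
  linarith

theorem differentiableAt_gaussIntegral {z : ℂ} (hz : 0 < z.re) :
    DifferentiableAt ℂ (fun w => gaussIntegral w 1) z := by
  have hpos : {w : ℂ | z.re / 2 < w.re} ∈ 𝓝 z :=
    (isOpen_lt continuous_const Complex.continuous_re).mem_nhds (by simp; linarith)
  refine (hasDerivAt_integral_of_dominated_loc_of_deriv_le
    (F := fun w t => gaussKernel w 1 t)
    (F' := fun w (t : ℝ) => t * Complex.exp (-w * t) / (1 - Complex.exp (-(t : ℂ)) * 1))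
    (bound := fun t => (1 + 4 / z.re) * Real.exp (-(z.re / 4) * t)) hpos
    (Eventually.of_forall fun w => (measurable_gaussKernel w 1).aestronglyMeasurable)
    (integrableOn_gaussKernel hz norm_one) ?_ ?_ ?_ ?_).2.differentiableAt
  · exact Measurable.aestronglyMeasurable (by fun_prop)
  · filter_upwards [ae_restrict_mem measurableSet_Ioi] with t ht w hw
    have ht0 : 0 < t := ht
    have hden := one_sub_exp_neg_le_norm norm_one t
    have hden' := div_one_add_le_one_sub_exp_neg ht0
    have hw' : z.re / 2 < w.re := hw
    have hnum : ‖(t : ℂ) * Complex.exp (-w * t)‖ ≤ t * Real.exp (-(z.re / 2) * t) := by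
      rw [norm_mul, Complex.norm_real, Real.norm_of_nonneg ht0.le, Complex.norm_exp,
        Complex.re_mul_ofReal, Complex.neg_re]
      gcongr
    have hlin : 1 + t ≤ (1 + 4 / z.re) * Real.exp (z.re / 4 * t) := by
      have e1 := Real.add_one_le_exp (z.re / 4 * t)
      have e2 : t = 4 / z.re * (z.re / 4 * t) := by field_simp
      have e3 : 0 < 4 / z.re := by positivity
      have e4 : 0 < z.re / 4 * t := by positivity
      have e5 : t ≤ 4 / z.re * Real.exp (z.re / 4 * t) := by
        calc t = 4 / z.re * (z.re / 4 * t) := e2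
          _ ≤ _ := by gcongr; linarith
      linarith
    rw [norm_div]
    calc _ ≤ t * Real.exp (-(z.re / 2) * t) / (t / (1 + t)) :=
          div_le_div₀ (by positivity) hnum (by positivity) (hden'.trans hden)
      _ = (1 + t) * Real.exp (-(z.re / 2) * t) := by field_simp
      _ ≤ (1 + 4 / z.re) * Real.exp (z.re / 4 * t) * Real.exp (-(z.re / 2) * t) := by gcongr
      _ = _ := by
          rw [mul_assoc, ← Real.exp_add]
          ring_nf
  · exact (exp_neg_integrableOn_Ioi 0 (by linarith)).const_mul _
  · filter_upwards with t w _
    have h1 : HasDerivAt (fun w : ℂ => Complex.exp (-w * t)) (Complex.exp (-w * t) * (-1 * t)) w :=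
      ((hasDerivAt_neg w).mul_const (t : ℂ)).cexp
    exact ((h1.const_sub (1 * Complex.exp (-(t : ℂ)))).div_const
      (1 - Complex.exp (-(t : ℂ)) * 1)).congr_deriv (by ring)

theorem le_of_monotoneOn_of_add_one {f g : ℝ → ℝ} (hf : MonotoneOn f (Ioi 0))
    (hg : MonotoneOn g (Ioi 0)) (hf' : ∀ x, 0 < x → f (x + 1) = f x + 1 / x)
    (hg' : ∀ x, 0 < x → g (x + 1) = g x + 1 / x) (h1 : f 1 = g 1) {x : ℝ} (hx : 0 < x) :
    f x ≤ g x := by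
  have hshift : ∀ (n : ℕ) (y : ℝ), 0 < y → f (y + n) - g (y + n) = f y - g y := by
    intro n y hy
    induction n with
    | zero => simp
    | succ n ih =>
      have hpos : 0 < y + n := by positivity
      push_cast
      rw [← add_assoc, hf' _ hpos, hg' _ hpos]
      linarith
  have hbound : ∀ n : ℕ, f x - g x ≤ 1 / ((n : ℝ) + 1) := by
    intro n
    obtain ⟨m, hm⟩ : ∃ m, ⌈x⌉₊ = m + 1 :=
      Nat.exists_eq_succ_of_ne_zero (Nat.ceil_pos.mpr hx).ne'
    have hxle : x ≤ m + 1 := by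
      have := Nat.le_ceil x
      rw [hm] at this
      exact_mod_cast this
    have hxge : (m : ℝ) < x := Nat.lt_ceil.mp (by omega)
    set N : ℝ := 1 + ((m + n : ℕ) : ℝ) with hN
    have hNpos : 0 < N := by positivity
    have hNe : N = m + n + 1 := by rw [hN]; push_cast; ring
    have hy : 0 < x + ((n + 1 : ℕ) : ℝ) := by positivity
    have hle : f (x + ((n + 1 : ℕ) : ℝ)) ≤ f (N + 1) :=
      hf hy (by simp only [mem_Ioi]; linarith) (by push_cast; linarith)
    have hge : g N ≤ g (x + ((n + 1 : ℕ) : ℝ)) :=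
      hg hNpos hy (by push_cast; linarith)
    have hfg : f N = g N := by
      have := hshift (m + n) 1 one_pos
      linarith
    have hfN := hf' N hNpos
    have hdiv : 1 / N ≤ 1 / ((n : ℝ) + 1) :=
      one_div_le_one_div_of_le (by positivity) (by
        rw [hNe]
        linarith [(Nat.cast_nonneg m : (0 : ℝ) ≤ m)])
    have := hshift (n + 1) x hx
    linarith
  have := ge_of_tendsto' (tendsto_one_div_add_atTop_nhds_zero_nat (𝕜 := ℝ)) hbound
  linarith

theorem eq_of_monotoneOn_of_add_one {f g : ℝ → ℝ} (hf : MonotoneOn f (Ioi 0))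
    (hg : MonotoneOn g (Ioi 0)) (hf' : ∀ x, 0 < x → f (x + 1) = f x + 1 / x)
    (hg' : ∀ x, 0 < x → g (x + 1) = g x + 1 / x) (h1 : f 1 = g 1) {x : ℝ} (hx : 0 < x) :
    f x = g x :=
  le_antisymm (le_of_monotoneOn_of_add_one hf hg hf' hg' h1 hx)
    (le_of_monotoneOn_of_add_one hg hf hg' hf' h1.symm hx)

theorem ne_neg_natCast_of_re_pos {z : ℂ} (hz : 0 < z.re) (m : ℕ) : z ≠ -m := by
  rintro rfl
  have : (0 : ℝ) ≤ m := m.cast_nonneg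
  simp at hz
  linarith

theorem digamma_eq_complex_digamma (z : ℂ) : _root_.digamma z = Complex.digamma z := rfl

theorem digamma_ofReal {y : ℝ} (hy : 0 < y) :
    _root_.digamma y = (deriv (Real.log ∘ Real.Gamma) y : ℝ) := by
  have hy' : ∀ m : ℕ, y ≠ -m := fun m h => by
    have : (0 : ℝ) ≤ m := m.cast_nonneg
    linarith
  have hreal := Real.differentiableAt_Gamma hy'
  have hcomplex := Complex.differentiableAt_Gamma (y : ℂ)
    (ne_neg_natCast_of_re_pos (by simpa using hy))
  have hderiv : deriv Complex.Gamma y = (deriv Real.Gamma y : ℝ) := by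
    have h1 := hcomplex.hasDerivAt.comp_ofReal
    simp only [Complex.Gamma_ofReal] at h1
    exact h1.unique hreal.hasDerivAt.ofReal_comp
  have hlog : deriv (Real.log ∘ Real.Gamma) y = deriv Real.Gamma y / Real.Gamma y :=
    (hreal.hasDerivAt.log (Real.Gamma_pos_of_pos hy).ne').deriv
  rw [_root_.digamma, hderiv, hlog, Complex.Gamma_ofReal]
  push_cast
  rfl

theorem digamma_add_one {z : ℂ} (hz : 0 < z.re) :
    _root_.digamma (z + 1) = _root_.digamma z + 1 / z := by
  rw [one_div]
  exact Complex.digamma_apply_add_one z (ne_neg_natCast_of_re_pos hz)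

theorem monotoneOn_re_digamma :
    MonotoneOn (fun y : ℝ => (_root_.digamma y).re) (Ioi 0) := by
  refine (Real.convexOn_log_Gamma.monotoneOn_deriv fun y hy => ?_).congr fun y hy => ?_
  · have hy0 : 0 < y := hy
    refine (Real.differentiableAt_log (Real.Gamma_pos_of_pos hy).ne').comp y
      (Real.differentiableAt_Gamma fun m h => ?_)
    have : (0 : ℝ) ≤ m := m.cast_nonneg
    linarith
  · simp only [digamma_ofReal hy, Complex.ofReal_re]

theorem gaussIntegral_ofReal_im (y : ℝ) : (gaussIntegral y 1).im = 0 := by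
  have h : gaussIntegral y 1 = ((∫ t in Ioi (0 : ℝ),
      (Real.exp (-t) - Real.exp (-y * t)) / (1 - Real.exp (-t)) : ℝ) : ℂ) := by
    rw [gaussIntegral, ← integral_complex_ofReal]
    refine integral_congr_ae (Eventually.of_forall fun t => ?_)
    simp only [gaussKernel]
    push_cast
    ring
  rw [h, Complex.ofReal_im]

theorem digamma_ofReal_eq_gaussIntegral {y : ℝ} (hy : 0 < y) :
    _root_.digamma y = gaussIntegral y 1 - Real.eulerMascheroniConstant := by
  have hre : (_root_.digamma y).re
      = (gaussIntegral y 1).re - Real.eulerMascheroniConstant := by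
    refine eq_of_monotoneOn_of_add_one (f := fun y : ℝ => (_root_.digamma y).re)
      (g := fun y : ℝ => (gaussIntegral y 1).re - Real.eulerMascheroniConstant)
      monotoneOn_re_digamma (fun a ha b hb hab => ?_) (fun x hx => ?_) (fun x hx => ?_) ?_ hy
    · exact sub_le_sub_right (monotoneOn_re_gaussIntegral ha hb hab) _
    · have := congrArg Complex.re (digamma_add_one (z := x) (by simpa using hx))
      rw [Complex.add_re] at this
      push_cast
      rw [this]
      norm_cast
    · have := congrArg Complex.re (gaussIntegral_add_one (z := x) (by simpa using hx))
      rw [Complex.add_re] at this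
      push_cast
      rw [this, add_sub_right_comm]
      norm_cast
    · simp [gaussIntegral_one_one, digamma_eq_complex_digamma, Complex.digamma_one]
  apply Complex.ext
  · simpa using hre
  · simp [gaussIntegral_ofReal_im, digamma_ofReal hy]

/-- Gauss' integral formula for the digamma function on the right half-plane. -/
theorem digamma_eq_gaussIntegral {z : ℂ} (hz : 0 < z.re) :
    _root_.digamma z = gaussIntegral z 1 - Real.eulerMascheroniConstant := by
  have hopen : IsOpen {w : ℂ | 0 < w.re} := isOpen_lt continuous_const Complex.continuous_re
  have hGamma : DifferentiableOn ℂ Complex.Gamma {w : ℂ | 0 < w.re} := fun w hw =>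
    (Complex.differentiableAt_Gamma w (ne_neg_natCast_of_re_pos hw)).differentiableWithinAt
  have hf : AnalyticOnNhd ℂ _root_.digamma {w : ℂ | 0 < w.re} :=
    ((hGamma.deriv hopen).div hGamma
      fun w hw => Complex.Gamma_ne_zero_of_re_pos hw).analyticOnNhd hopen
  have hg : AnalyticOnNhd ℂ (fun w => gaussIntegral w 1 - Real.eulerMascheroniConstant)
      {w : ℂ | 0 < w.re} :=
    DifferentiableOn.analyticOnNhd (fun w hw =>
      ((differentiableAt_gaussIntegral hw).sub_const _).differentiableWithinAt) hopen
  refine hf.eqOn_of_preconnected_of_frequently_eq hg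
    (convex_halfSpace_re_gt 0).isPreconnected (z₀ := 1) (by simp) ?_ hz
  have htend : Tendsto (fun y : ℝ => (y : ℂ)) (𝓝[≠] 1) (𝓝[≠] 1) := by
    refine tendsto_nhdsWithin_iff.mpr ⟨?_, ?_⟩
    · exact (Complex.continuous_ofReal.tendsto' 1 1 (by simp)).mono_left nhdsWithin_le_nhds
    · filter_upwards [self_mem_nhdsWithin] with y hy
      simpa using hy
  refine htend.frequently (Eventually.frequently ?_)
  filter_upwards [nhdsWithin_le_nhds (Ioi_mem_nhds one_pos)] with y hy
  exact digamma_ofReal_eq_gaussIntegral hy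

theorem half_norm_one_sub_le {b : ℂ} (hb : ‖b‖ = 1) {t : ℝ} (ht : 0 ≤ t) :
    ‖1 - b‖ / 2 ≤ ‖1 - Complex.exp (-(t : ℂ)) * b‖ := by
  have h1 := one_sub_exp_neg_le_norm hb t
  have h2 : ‖1 - b‖ ≤ ‖1 - Complex.exp (-(t : ℂ)) * b‖ + (1 - Real.exp (-t)) := by
    have hsplit : 1 - b = (1 - Complex.exp (-(t : ℂ)) * b)
        + ((Real.exp (-t) - 1 : ℝ) : ℂ) * b := by
      push_cast
      ring
    have hle : Real.exp (-t) - 1 ≤ 0 := by simpa using ht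
    calc ‖1 - b‖ ≤ ‖1 - Complex.exp (-(t : ℂ)) * b‖ + ‖((Real.exp (-t) - 1 : ℝ) : ℂ) * b‖ := by
          rw [hsplit]
          exact norm_add_le _ _
      _ = _ := by
          rw [norm_mul, hb, mul_one, Complex.norm_real, Real.norm_of_nonpos hle, neg_sub]
  linarith

theorem norm_exp_neg_mul_div_le {w b : ℂ} {s t : ℝ} (hw : s ≤ w.re) (hb : ‖b‖ = 1) (hb1 : b ≠ 1)
    (ht : 0 ≤ t) : ‖Complex.exp (-w * t) / (1 - Complex.exp (-(t : ℂ)) * b)‖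
      ≤ 2 / ‖1 - b‖ * Real.exp (-s * t) := by
  have hpos : 0 < ‖1 - b‖ := norm_pos_iff.mpr (sub_ne_zero.mpr hb1.symm)
  rw [norm_div, Complex.norm_exp, Complex.re_mul_ofReal, Complex.neg_re]
  calc _ ≤ Real.exp (-s * t) / (‖1 - b‖ / 2) :=
        div_le_div₀ (by positivity) (by gcongr) (by positivity) (half_norm_one_sub_le hb ht)
    _ = _ := by field_simp

theorem integrableOn_exp_neg_mul_div {w b : ℂ} (hw : 0 < w.re) (hb : ‖b‖ = 1) (hb1 : b ≠ 1) :
    IntegrableOn (fun t : ℝ => Complex.exp (-w * t) / (1 - Complex.exp (-(t : ℂ)) * b))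
      (Ioi 0) := by
  refine ((exp_neg_integrableOn_Ioi 0 hw).const_mul (2 / ‖1 - b‖)).mono'
    (Measurable.aestronglyMeasurable (by fun_prop)) ?_
  filter_upwards [ae_restrict_mem measurableSet_Ioi] with t ht
  exact norm_exp_neg_mul_div_le le_rfl hb hb1 (le_of_lt ht)

theorem one_sub_mul_mem_slitPlane {b : ℂ} (hb : ‖b‖ = 1) (hb1 : b ≠ 1) {r : ℝ} (hr : 0 ≤ r)
    (hr1 : r ≤ 1) : 1 - (r : ℂ) * b ∈ Complex.slitPlane := by
  have hre : b.re < 1 := by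
    refine lt_of_le_of_ne ((Complex.re_le_norm b).trans hb.le) fun h => hb1 ?_
    have h2 := Complex.sq_norm b
    rw [hb, Complex.normSq_apply, h] at h2
    apply Complex.ext
    · simpa using h
    · simp only [Complex.one_im]
      nlinarith
  left
  simp only [Complex.sub_re, Complex.one_re, Complex.re_ofReal_mul]
  rcases hr.eq_or_lt with h | h
  · rw [← h]
    norm_num
  · nlinarith

theorem integral_mul_exp_neg_div {b : ℂ} (hb : ‖b‖ = 1) (hb1 : b ≠ 1) :
    ∫ t in Ioi (0 : ℝ), b * Complex.exp (-(t : ℂ)) / (1 - Complex.exp (-(t : ℂ)) * b)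
      = -Complex.log (1 - b) := by
  have hmem : ∀ t : ℝ, 0 ≤ t → 1 - Complex.exp (-(t : ℂ)) * b ∈ Complex.slitPlane := by
    intro t ht
    have := one_sub_mul_mem_slitPlane hb hb1 (Real.exp_pos (-t)).le (by simpa using ht)
    push_cast at this
    exact this
  have hderiv : ∀ t ∈ Ici (0 : ℝ), HasDerivAt
      (fun t : ℝ => Complex.log (1 - Complex.exp (-(t : ℂ)) * b))
      (b * Complex.exp (-(t : ℂ)) / (1 - Complex.exp (-(t : ℂ)) * b)) t := by
    intro t ht
    have h1 : HasDerivAt (fun w : ℂ => Complex.log (1 - Complex.exp (-w) * b))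
        (b * Complex.exp (-(t : ℂ)) / (1 - Complex.exp (-(t : ℂ)) * b)) t :=
      ((((hasDerivAt_neg (t : ℂ)).cexp.mul_const b).const_sub 1).clog (hmem t ht)).congr_deriv
        (by ring)
    exact h1.comp_ofReal
  have hint : IntegrableOn
      (fun t : ℝ => b * Complex.exp (-(t : ℂ)) / (1 - Complex.exp (-(t : ℂ)) * b)) (Ioi 0) := by
    have := (integrableOn_exp_neg_mul_div (w := 1) (by simp) hb hb1).const_mul b
    simpa only [IntegrableOn, neg_one_mul, mul_div_assoc] using this
  have hlim : Tendsto (fun t : ℝ => Complex.log (1 - Complex.exp (-(t : ℂ)) * b)) atTop (𝓝 0) := by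
    have h1 : Tendsto (fun t : ℝ => 1 - ((Real.exp (-t) : ℝ) : ℂ) * b) atTop (𝓝 1) := by
      have h0 : Tendsto (fun t : ℝ => ((Real.exp (-t) : ℝ) : ℂ)) atTop (𝓝 ((0 : ℝ) : ℂ)) :=
        (Complex.continuous_ofReal.tendsto 0).comp
          (Real.tendsto_exp_atBot.comp tendsto_neg_atTop_atBot)
      simpa using (h0.mul_const b).const_sub 1
    have h2 := h1.clog Complex.one_mem_slitPlane
    simpa using h2
  rw [integral_Ioi_of_hasDerivAt_of_tendsto
    (hderiv 0 self_mem_Ici).continuousAt.continuousWithinAt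
    (fun t ht => hderiv t (mem_Ici_of_Ioi ht)) hint hlim]
  simp

theorem integral_exp_neg_mul_div {w b : ℂ} (hw : 0 < w.re) (hb : ‖b‖ = 1) (hb1 : b ≠ 1) :
    ∫ t in Ioi (0 : ℝ), Complex.exp (-w * t) / (1 - Complex.exp (-(t : ℂ)) * b)
      = -Complex.log (1 - b) - gaussIntegral w b := by
  have h1 := integral_sub (integrableOn_gaussKernel hw hb) (μ := volume.restrict (Ioi 0))
    (integrableOn_exp_neg_mul_div hw hb hb1).neg
  have h2 : ∀ t : ℝ, gaussKernel w b t
      - (-fun t : ℝ => Complex.exp (-w * t) / (1 - Complex.exp (-(t : ℂ)) * b)) t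
      = b * Complex.exp (-(t : ℂ)) / (1 - Complex.exp (-(t : ℂ)) * b) := by
    intro t
    simp only [gaussKernel, Pi.neg_apply]
    ring
  simp only [h2] at h1
  rw [integral_mul_exp_neg_div hb hb1] at h1
  simp only [Pi.neg_apply, integral_neg] at h1
  rw [gaussIntegral, h1]
  ring

theorem norm_e2pi (θ : ℝ) : ‖e2pi θ‖ = 1 := by
  have : (2 * Real.pi * Complex.I * θ : ℂ) = ((2 * Real.pi * θ : ℝ) : ℂ) * Complex.I := by
    push_cast
    ring
  rw [e2pi, this, Complex.norm_exp_ofReal_mul_I]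

theorem continuous_e2pi : Continuous e2pi := by
  unfold e2pi
  fun_prop

theorem e2pi_zero : e2pi 0 = 1 := by simp [e2pi]

theorem e2pi_ne_one {θ : ℝ} (hθ : ∀ m : ℤ, θ ≠ m) : e2pi θ ≠ 1 := by
  rw [e2pi, Ne, Complex.exp_eq_one_iff]
  rintro ⟨n, hn⟩
  apply hθ n
  have h : (2 * Real.pi * Complex.I : ℂ) * θ = (2 * Real.pi * Complex.I : ℂ) * n := by
    rw [hn]
    ring
  exact_mod_cast mul_left_cancel₀ Complex.two_pi_I_ne_zero h

theorem Li_of_two_le {m : ℕ} (hm : 2 ≤ m) (z : ℂ) :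
    Li m z = ∑' n : ℕ, z ^ (n + 1) / ((n + 1 : ℕ) : ℂ) ^ m := by
  obtain ⟨m, rfl⟩ := Nat.exists_eq_add_of_le' hm
  rfl

theorem summable_one_div_add_one_pow {m : ℕ} (hm : 2 ≤ m) :
    Summable fun n : ℕ => 1 / ((n + 1 : ℕ) : ℝ) ^ m :=
  (summable_nat_add_iff 1).mpr (Real.summable_one_div_nat_pow.mpr hm)

theorem norm_pow_div_add_one_pow {a : ℂ} (ha : ‖a‖ = 1) (m n : ℕ) :
    ‖a ^ (n + 1) / ((n + 1 : ℕ) : ℂ) ^ m‖ = 1 / ((n + 1 : ℕ) : ℝ) ^ m := by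
  rw [norm_div, norm_pow, norm_pow, ha, one_pow, Complex.norm_natCast]

theorem re_le_re_natCast_mul {x : ℂ} (hx : 0 < x.re) (n : ℕ) :
    x.re ≤ (((n + 1 : ℕ) : ℂ) * x).re := by
  rw [← Complex.ofReal_natCast, Complex.re_ofReal_mul]
  have : (0 : ℝ) ≤ n := n.cast_nonneg
  push_cast
  nlinarith

theorem summable_sqrt_div {m : ℕ} (hm : 2 ≤ m) (A B r : ℝ) :
    Summable fun n : ℕ =>
      (A * (1 + √(((n + 1 : ℕ) : ℝ) * r)) + B) * (1 / ((n + 1 : ℕ) : ℝ) ^ m) := by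
  have h1 := (summable_one_div_add_one_pow hm).mul_left (A + B)
  have h2 : Summable fun n : ℕ => √((n + 1 : ℕ) : ℝ) * (1 / ((n + 1 : ℕ) : ℝ) ^ m) := by
    have h3 : Summable fun n : ℕ => 1 / ((n + 1 : ℕ) : ℝ) ^ (m - 1 / 2 : ℝ) := by
      refine (summable_nat_add_iff 1).mpr (Real.summable_one_div_nat_rpow.mpr ?_)
      have : (2 : ℝ) ≤ m := by exact_mod_cast hm
      linarith
    refine h3.congr fun n => ?_
    have hn : (0 : ℝ) < ((n + 1 : ℕ) : ℝ) := by positivity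
    rw [Real.rpow_sub hn, Real.rpow_natCast, Real.sqrt_eq_rpow]
    field_simp
  refine (h1.add (h2.mul_left (A * √r))).congr fun n => ?_
  rw [Real.sqrt_mul (by positivity)]
  ring

theorem hasSum_HHZN {k : ℕ} (hk : 3 ≤ k) {x : ℂ} (hx : 0 < x.re) (α : ℝ) {β : ℝ}
    (hβ : ∀ m : ℤ, β ≠ m) :
    HasSum (fun n : ℕ => e2pi α ^ (n + 1) / ((n + 1 : ℕ) : ℂ) ^ (k - 1) *
      (-Complex.log (1 - e2pi β) - gaussIntegral (((n + 1 : ℕ) : ℂ) * x) (e2pi β)))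
      (HHZN k x α β) := by
  have hb := norm_e2pi β
  have hb1 := e2pi_ne_one hβ
  have hm : 2 ≤ k - 1 := by omega
  have hre := re_le_re_natCast_mul hx
  set F : ℕ → ℝ → ℂ := fun n t => e2pi α ^ (n + 1) / ((n + 1 : ℕ) : ℂ) ^ (k - 1) *
    (Complex.exp (-(((n + 1 : ℕ) : ℂ) * x) * t) / (1 - Complex.exp (-(t : ℂ)) * e2pi β)) with hF
  have hFint : ∀ n, Integrable (F n) (volume.restrict (Ioi 0)) := fun n =>
    (integrableOn_exp_neg_mul_div (hx.trans_le (hre n)) hb hb1).const_mul _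
  have hFsum : Summable fun n => ∫ t in Ioi (0 : ℝ), ‖F n t‖ := by
    refine Summable.of_nonneg_of_le (fun n => integral_nonneg fun t => norm_nonneg _)
      (fun n => ?_) ((summable_one_div_add_one_pow hm).mul_right
        (∫ t in Ioi (0 : ℝ), 2 / ‖1 - e2pi β‖ * Real.exp (-x.re * t)))
    rw [← integral_const_mul]
    refine setIntegral_mono_on (hFint n).norm
      (((exp_neg_integrableOn_Ioi 0 hx).const_mul _).const_mul _) measurableSet_Ioi
      fun t ht => ?_
    rw [hF, norm_mul, norm_pow_div_add_one_pow (norm_e2pi α)]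
    gcongr
    exact norm_exp_neg_mul_div_le (hre n) hb hb1 (le_of_lt ht)
  have hmain := hasSum_integral_of_summable_integral_norm hFint hFsum
  have hsum : ∫ t in Ioi (0 : ℝ), ∑' n, F n t = HHZN k x α β := by
    rw [HHZN]
    refine setIntegral_congr_fun measurableSet_Ioi fun t _ => ?_
    simp only [hF, Li_of_two_le hm]
    rw [← tsum_div_const]
    refine tsum_congr fun n => ?_
    have hexp : Complex.exp (-(((n + 1 : ℕ) : ℂ) * x) * t) = Complex.exp (-x * t) ^ (n + 1) := by
      rw [← Complex.exp_nat_mul]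
      ring_nf
    rw [hexp, mul_pow]
    ring
  rw [hsum] at hmain
  refine hmain.congr_fun fun n => ?_
  rw [hF, integral_const_mul, integral_exp_neg_mul_div (hx.trans_le (hre n)) hb hb1]

/-- The higher Herglotz function `𝓕_k(x) = ∑_{n≥1} ψ(nx)/n^{k-1}` of Vlasenko–Zagier is a
limiting case of `𝓕_k(x; α, β)` as `(α, β) → (0,0)` through nonintegral pairs, for `k ≥ 3`. -/
theorem higher_herglotz_limit_of_HHZN (k : ℕ) (hk : 3 ≤ k) (x : ℂ) (hx : 0 < x.re) :
    Summable (fun n : ℕ => ‖_root_.digamma ((n + 1) * x) / ((n + 1 : ℕ) : ℂ) ^ (k - 1)‖) ∧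
    Tendsto
      (fun p : ℝ × ℝ =>
        -HHZN k x p.1 p.2 -
          ((Real.eulerMascheroniConstant : ℂ) + Complex.log (1 - e2pi p.2)) *
            Li (k - 1) (e2pi p.1))
      (𝓝[{p : ℝ × ℝ | (∀ m : ℤ, p.1 ≠ m) ∧ (∀ m : ℤ, p.2 ≠ m)}] (0, 0))
      (𝓝 (∑' n : ℕ, _root_.digamma ((n + 1) * x) / ((n + 1 : ℕ) : ℂ) ^ (k - 1))) := by
  have hm : 2 ≤ k - 1 := by omega
  have hre := re_le_re_natCast_mul hx
  set γ : ℝ := Real.eulerMascheroniConstant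
  set M : ℝ := 12 * ∫ t in Ioi (0 : ℝ), gaussMajorant x.re t with hM
  have hbd : ∀ (b : ℂ) (n : ℕ), ‖b‖ = 1 → ‖gaussIntegral (((n + 1 : ℕ) : ℂ) * x) b - γ‖
      ≤ M * (1 + √(((n + 1 : ℕ) : ℝ) * ‖x‖)) + |γ| := by
    intro b n hb
    refine (norm_sub_le _ _).trans (add_le_add ?_ (by simp))
    refine (norm_gaussIntegral_le hx (hre n) hb).trans_eq ?_
    rw [norm_mul, Complex.norm_natCast, hM]
    ring
  have hbound : ∀ (a b : ℂ) (n : ℕ), ‖a‖ = 1 → ‖b‖ = 1 →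
      ‖a ^ (n + 1) / ((n + 1 : ℕ) : ℂ) ^ (k - 1) *
        (gaussIntegral (((n + 1 : ℕ) : ℂ) * x) b - γ)‖
      ≤ (M * (1 + √(((n + 1 : ℕ) : ℝ) * ‖x‖)) + |γ|) * (1 / ((n + 1 : ℕ) : ℝ) ^ (k - 1)) := by
    intro a b n ha hb
    rw [norm_mul, norm_pow_div_add_one_pow ha, mul_comm]
    exact mul_le_mul_of_nonneg_right (hbd b n hb) (by positivity)
  have hsummable := summable_sqrt_div hm M |γ| ‖x‖
  have hterm : ∀ n : ℕ, _root_.digamma ((n + 1) * x) / ((n + 1 : ℕ) : ℂ) ^ (k - 1)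
      = 1 ^ (n + 1) / ((n + 1 : ℕ) : ℂ) ^ (k - 1) *
        (gaussIntegral (((n + 1 : ℕ) : ℂ) * x) 1 - γ) := by
    intro n
    rw [← digamma_eq_gaussIntegral (hx.trans_le (hre n))]
    push_cast
    ring
  simp only [hterm]
  refine ⟨hsummable.of_nonneg_of_le (fun n => norm_nonneg _)
    fun n => hbound 1 1 n norm_one norm_one, ?_⟩
  have hlim := tendsto_tsum_of_dominated_convergence
    (𝓕 := 𝓝[{p : ℝ × ℝ | (∀ m : ℤ, p.1 ≠ m) ∧ (∀ m : ℤ, p.2 ≠ m)}] (0, 0))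
    (f := fun p n => e2pi p.1 ^ (n + 1) / ((n + 1 : ℕ) : ℂ) ^ (k - 1) *
      (gaussIntegral (((n + 1 : ℕ) : ℂ) * x) (e2pi p.2) - γ))
    (g := fun n => 1 ^ (n + 1) / ((n + 1 : ℕ) : ℂ) ^ (k - 1) *
      (gaussIntegral (((n + 1 : ℕ) : ℂ) * x) 1 - γ)) hsummable ?_
    (Eventually.of_forall fun p n => hbound _ _ n (norm_e2pi _) (norm_e2pi _))
  · refine hlim.congr' ?_
    filter_upwards [self_mem_nhdsWithin] with p hp
    have hsum := hasSum_HHZN hk hx p.1 hp.2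
    have hLi : HasSum (fun n : ℕ => e2pi p.1 ^ (n + 1) / ((n + 1 : ℕ) : ℂ) ^ (k - 1))
        (Li (k - 1) (e2pi p.1)) := by
      rw [Li_of_two_le hm]
      refine (Summable.of_norm ?_).hasSum
      simpa only [norm_pow_div_add_one_pow (norm_e2pi p.1)] using summable_one_div_add_one_pow hm
    have := hsum.neg.sub (hLi.mul_left ((γ : ℂ) + Complex.log (1 - e2pi p.2)))
    rw [← this.tsum_eq]
    refine tsum_congr fun n => ?_
    ring
  · intro n
    have h1 : Tendsto (fun p : ℝ × ℝ => e2pi p.1)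
        (𝓝[{p : ℝ × ℝ | (∀ m : ℤ, p.1 ≠ m) ∧ (∀ m : ℤ, p.2 ≠ m)}] (0, 0)) (𝓝 1) :=
      ((continuous_e2pi.comp continuous_fst).tendsto' (0, 0) 1 e2pi_zero).mono_left
        nhdsWithin_le_nhds
    have h2 : Tendsto (fun p : ℝ × ℝ => e2pi p.2)
        (𝓝[{p : ℝ × ℝ | (∀ m : ℤ, p.1 ≠ m) ∧ (∀ m : ℤ, p.2 ≠ m)}] (0, 0)) (𝓝 1) :=
      ((continuous_e2pi.comp continuous_snd).tendsto' (0, 0) 1 e2pi_zero).mono_left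
        nhdsWithin_le_nhds
    have h3 := tendsto_gaussIntegral (hx.trans_le (hre n)) (fun p : ℝ × ℝ => norm_e2pi p.2)
      norm_one h2
    have h4 := (h1.pow (n + 1)).div_const (((n + 1 : ℕ) : ℂ) ^ (k - 1))
    exact h4.mul (h3.sub_const (γ : ℂ))

end
end

section
/- Let x > 0 be real and 0 < β < 1. Then ∫₀^∞ e^{−xt}/(1 − e^{−t} e^{2πiβ}) dt = 1/(2x) − (i/(2πx))·(ψ(β) − ψ(1−β)) + i·∫_{−∞}^{∞} (1/(it − x) + 1/x) · e^{2πβt}/(e^{2πt} − 1) dt, where both integrals converge absolutely (the integrand of the second integral extends continuously across t = 0, since 1/(it−x) + 1/x vanishes to first order there while e^{2πβt}/(e^{2πt}−1) has a simple pole). -/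
open Complex MeasureTheory Filter Topology Set Asymptotics

noncomputable section

/-- The logarithmic derivative of Euler's reflection formula. -/
theorem digamma_sub_digamma_one_sub {z : ℂ} (hz : z ∈ integerComplement) :
    _root_.digamma z - _root_.digamma (1 - z) = -(Real.pi * cot (Real.pi * z)) := by
  have hz1 : ∀ m : ℕ, z ≠ -m := fun m h => hz ⟨-m, by simp [h]⟩
  have hz2 : ∀ m : ℕ, 1 - z ≠ -m := fun m h => hz ⟨1 + m, by
    push_cast; linear_combination h⟩
  have hs : sin (Real.pi * z) ≠ 0 := sin_pi_mul_ne_zero hz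
  have hpi : (Real.pi : ℂ) ≠ 0 := by exact_mod_cast Real.pi_ne_zero
  have hG1 := Gamma_ne_zero hz1
  have hG2 := Gamma_ne_zero hz2
  have hd1 := (differentiableAt_Gamma z hz1).hasDerivAt
  have hd2 := (differentiableAt_Gamma (1 - z) hz2).hasDerivAt.comp_const_sub 1 z
  have hl := hd1.mul hd2
  have hsin : HasDerivAt (fun w : ℂ => sin (Real.pi * w)) (cos (Real.pi * z) * Real.pi) z := by
    simpa using (hasDerivAt_id z).const_mul (Real.pi : ℂ) |>.csin
  have hr := (hsin.inv hs).const_mul (Real.pi : ℂ)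
  have hfun : (Gamma * fun w : ℂ => Gamma (1 - w)) =
      fun w : ℂ => (Real.pi : ℂ) * (fun w : ℂ => sin (Real.pi * w))⁻¹ w := by
    ext w
    simpa [div_eq_mul_inv] using Gamma_mul_Gamma_one_sub w
  rw [hfun] at hl
  have key := hl.unique hr
  have href := Gamma_mul_Gamma_one_sub z
  have : deriv Gamma z * Gamma (1 - z) - Gamma z * deriv Gamma (1 - z) =
      -(Real.pi * cot (Real.pi * z)) * (Gamma z * Gamma (1 - z)) := by
    rw [href, cot]
    field_simp at key ⊢
    linear_combination key
  rw [_root_.digamma, _root_.digamma, div_sub_div _ _ hG1 hG2, div_eq_iff (mul_ne_zero hG1 hG2),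
    this]

theorem ofReal_add_mem_integerComplement {β : ℝ} (hβ0 : 0 < β) (hβ1 : β < 1) (y : ℝ) :
    (β + I * y : ℂ) ∈ integerComplement := by
  rintro ⟨n, hn⟩
  have h := congrArg re hn
  simp at h
  rw [← h] at hβ0 hβ1
  norm_cast at hβ0 hβ1
  omega

theorem integrableOn_mul_exp_neg_mul_Ioi {a : ℝ} (ha : 0 < a) :
    IntegrableOn (fun t : ℝ => t * Real.exp (-a * t)) (Ioi 0) := by
  simpa using integrableOn_rpow_mul_exp_neg_mul_rpow (p := 1) (s := 1) (by norm_num) one_pos ha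

theorem integral_mul_exp_neg_mul_Ioi {a : ℝ} (ha : 0 < a) :
    ∫ t in Ioi (0 : ℝ), t * Real.exp (-a * t) = (a ^ 2)⁻¹ := by
  have h := Real.integral_rpow_mul_exp_neg_mul_Ioi (a := 2) two_pos ha
  norm_num at h
  simpa using h

theorem norm_one_sub_exp_I_mul_le (s t : ℝ) : ‖1 - cexp (I * s * t)‖ ≤ |s| * |t| := by
  have h := Real.norm_exp_I_mul_ofReal_sub_one_le (x := s * t)
  rw [norm_sub_rev]
  simpa [mul_assoc, abs_mul] using h

/-- The integral against a geometric series of exponentials, term by term. -/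
theorem hasSum_integral_one_sub_exp {c : ℝ} (hc : 0 < c) (s : ℝ) :
    HasSum (fun n : ℕ => ((2 * Real.pi * (n + c) : ℂ))⁻¹ - (2 * Real.pi * (n + c) - I * s)⁻¹)
      (∫ t in Ioi (0 : ℝ), (1 - cexp (I * s * t)) *
        ((Real.exp (-(2 * Real.pi * c) * t) / (1 - Real.exp (-(2 * Real.pi) * t)) : ℝ) : ℂ)) := by
  set a : ℕ → ℝ := fun n => 2 * Real.pi * (n + c) with ha_def
  have ha : ∀ n, 0 < a n := fun n => by have := Real.pi_pos; positivity
  set F : ℕ → ℝ → ℂ := fun n t => (1 - cexp (I * s * t)) * (Real.exp (-a n * t) : ℂ) with hF_def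
  have hFeq : ∀ n, F n = fun t : ℝ => cexp (-(a n : ℂ) * t) - cexp ((-(a n : ℂ) + I * s) * t) := by
    intro n
    ext t
    simp only [hF_def]
    push_cast
    rw [sub_mul, one_mul, ← Complex.exp_add]
    ring_nf
  have hre1 : ∀ n, (-(a n : ℂ)).re < 0 := fun n => by simpa using ha n
  have hre2 : ∀ n, (-(a n : ℂ) + I * s).re < 0 := fun n => by simpa using ha n
  have hFint : ∀ n, Integrable (F n) (volume.restrict (Ioi 0)) := by
    intro n
    rw [hFeq]
    exact (integrableOn_exp_mul_complex_Ioi (hre1 n) 0).sub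
      (integrableOn_exp_mul_complex_Ioi (hre2 n) 0)
  have hFnorm : ∀ n, ∫ t in Ioi (0 : ℝ), ‖F n t‖ ≤ |s| * (a n ^ 2)⁻¹ := by
    intro n
    rw [← integral_mul_exp_neg_mul_Ioi (ha n), ← integral_const_mul]
    refine setIntegral_mono_on (hFint n).norm
      ((integrableOn_mul_exp_neg_mul_Ioi (ha n)).const_mul _) measurableSet_Ioi ?_
    intro t ht
    rw [norm_mul, norm_real, Real.norm_of_nonneg (Real.exp_pos _).le, ← mul_assoc]
    gcongr
    simpa [abs_of_pos (show (0 : ℝ) < t from ht)] using norm_one_sub_exp_I_mul_le s t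
  have hsum : Summable fun n : ℕ => |s| * (a n ^ 2)⁻¹ := by
    have h := (Real.summable_one_div_nat_add_rpow c 2).mpr (by norm_num)
    refine ((h.mul_left ((2 * Real.pi) ^ 2)⁻¹).mul_left |s|).congr fun n => ?_
    have : (0 : ℝ) < n + c := by positivity
    simp [ha_def, mul_pow, abs_of_pos this, mul_comm]
  have key := hasSum_integral_of_summable_integral_norm hFint
    (hsum.of_nonneg_of_le (fun n => integral_nonneg fun t => norm_nonneg (F n t)) hFnorm)
  have hterm : ∀ n : ℕ, ∫ t in Ioi (0 : ℝ), F n t =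
      ((2 * Real.pi * (n + c) : ℂ))⁻¹ - (2 * Real.pi * (n + c) - I * s)⁻¹ := by
    intro n
    rw [hFeq, integral_sub (integrableOn_exp_mul_complex_Ioi (hre1 n) 0)
      (integrableOn_exp_mul_complex_Ioi (hre2 n) 0), integral_exp_mul_complex_Ioi (hre1 n),
      integral_exp_mul_complex_Ioi (hre2 n)]
    have h1 : (2 * Real.pi * (n + c) - I * s : ℂ) = -(-(a n : ℂ) + I * s) := by
      simp only [ha_def]; push_cast; ring
    rw [h1, inv_neg]
    simp [ha_def, div_eq_mul_inv]
  simp only [hterm] at key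
  rw [setIntegral_congr_fun (g := fun t => ∑' n, F n t) measurableSet_Ioi]
  · exact key
  intro t ht
  have hr : Real.exp (-(2 * Real.pi) * t) < 1 := by
    rw [Real.exp_lt_one_iff]
    have := mul_pos Real.two_pi_pos (show (0 : ℝ) < t from ht)
    linarith
  have hgeom := (hasSum_geometric_of_lt_one (Real.exp_pos _).le hr).mul_left
    (Real.exp (-(2 * Real.pi * c) * t))
  have hF : ∀ n, Real.exp (-(2 * Real.pi * c) * t) * Real.exp (-(2 * Real.pi) * t) ^ n =
      Real.exp (-a n * t) := by
    intro n
    rw [← Real.exp_nat_mul, ← Real.exp_add]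
    simp only [ha_def]
    ring_nf
  simp only [hF, ← div_eq_mul_inv] at hgeom
  exact ((hasSum_ofReal.mpr hgeom).mul_left _).tsum_eq.symm

/-- The kernel `e^{2πβt}/(e^{2πt}-1)`. -/
def binetKernel (β t : ℝ) : ℝ :=
  Real.exp (2 * Real.pi * β * t) / (Real.exp (2 * Real.pi * t) - 1)

theorem binetKernel_eq (β t : ℝ) : binetKernel β t =
    Real.exp (-(2 * Real.pi * (1 - β)) * t) / (1 - Real.exp (-(2 * Real.pi) * t)) := by
  have h1 : Real.exp (-(2 * Real.pi * (1 - β)) * t) =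
      Real.exp (2 * Real.pi * β * t) * Real.exp (-(2 * Real.pi) * t) := by
    rw [← Real.exp_add]; ring_nf
  have h2 : 1 - Real.exp (-(2 * Real.pi) * t) =
      (Real.exp (2 * Real.pi * t) - 1) * Real.exp (-(2 * Real.pi) * t) := by
    rw [sub_mul, ← Real.exp_add]; simp
  rw [binetKernel, h1, h2, mul_div_mul_right _ _ (Real.exp_pos _).ne']

theorem binetKernel_neg (β t : ℝ) : binetKernel β (-t) = -binetKernel (1 - β) t := by
  rw [binetKernel_eq (1 - β), binetKernel, ← div_neg]
  ring_nf

theorem measurable_binetKernel (β : ℝ) : Measurable (binetKernel β) := by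
  unfold binetKernel
  fun_prop

theorem integrableOn_mul_binetKernel_Ioi {β : ℝ} (hβ1 : β < 1) :
    IntegrableOn (fun t => t * binetKernel β t) (Ioi 0) := by
  have hb : 0 < 2 * Real.pi * (1 - β) := mul_pos Real.two_pi_pos (by linarith)
  have hint := (integrableOn_mul_exp_neg_mul_Ioi hb).add
    ((integrableOn_exp_mul_Ioi (neg_lt_zero.mpr hb) 0).const_mul (2 * Real.pi)⁻¹)
  refine Integrable.mono' hint
    (measurable_id.mul (measurable_binetKernel β)).aestronglyMeasurable ?_
  filter_upwards [ae_restrict_mem measurableSet_Ioi] with t ht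
  have ht : 0 < t := ht
  have hpt : 0 < 2 * Real.pi * t := mul_pos Real.two_pi_pos ht
  have hr : Real.exp (-(2 * Real.pi) * t) < 1 := by
    rw [Real.exp_lt_one_iff]; linarith
  have hden : t ≤ (t + (2 * Real.pi)⁻¹) * (1 - Real.exp (-(2 * Real.pi) * t)) := by
    have h := Real.add_one_le_exp (2 * Real.pi * t)
    have h' : Real.exp (-(2 * Real.pi) * t) * Real.exp (2 * Real.pi * t) = 1 := by
      rw [← Real.exp_add]; simp
    have h2 : Real.exp (-(2 * Real.pi) * t) * (2 * Real.pi * t + 1) ≤ 1 := by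
      exact (mul_le_mul_of_nonneg_left h (Real.exp_pos _).le).trans_eq h'
    have hp := Real.pi_pos
    have h3 : (t + (2 * Real.pi)⁻¹) = (2 * Real.pi)⁻¹ * (2 * Real.pi * t + 1) := by
      field_simp
    have h4 : t = (2 * Real.pi)⁻¹ * (2 * Real.pi * t) := by field_simp
    rw [h3, mul_assoc]
    conv_lhs => rw [h4]
    refine mul_le_mul_of_nonneg_left ?_ (by positivity)
    linarith
  have hpos : 0 < 1 - Real.exp (-(2 * Real.pi) * t) := by linarith
  rw [binetKernel_eq, Real.norm_of_nonneg (by positivity), ← mul_div_assoc, div_le_iff₀ hpos]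
  simp only [Pi.add_apply]
  have := mul_le_mul_of_nonneg_left hden (Real.exp_pos (-(2 * Real.pi * (1 - β)) * t)).le
  linarith

theorem integrable_mul_binetKernel {β : ℝ} (hβ0 : 0 < β) (hβ1 : β < 1) :
    Integrable (fun t => t * binetKernel β t) := by
  have hneg := (integrableOn_mul_binetKernel_Ioi (β := 1 - β) (by linarith))
  rw [← neg_zero] at hneg
  have hneg := hneg.comp_neg_Iio
  rw [← integrableOn_Iic_iff_integrableOn_Iio] at hneg
  rw [← integrableOn_univ, ← Iic_union_Ioi (a := (0 : ℝ))]
  refine IntegrableOn.union (hneg.congr_fun (fun t _ => ?_) measurableSet_Iic)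
    (integrableOn_mul_binetKernel_Ioi hβ1)
  simp only [binetKernel_neg]
  ring_nf

theorem integrable_one_sub_exp_mul_binetKernel {β : ℝ} (hβ0 : 0 < β) (hβ1 : β < 1) (s : ℝ) :
    Integrable (fun t : ℝ => (1 - cexp (I * s * t)) * (binetKernel β t : ℂ)) := by
  refine Integrable.mono' ((integrable_mul_binetKernel hβ0 hβ1).norm.const_mul |s|) ?_ ?_
  · have := measurable_binetKernel β
    exact Measurable.aestronglyMeasurable (by fun_prop)
  · filter_upwards with t
    rw [norm_mul, norm_mul, ← mul_assoc, norm_real]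
    gcongr
    exact norm_one_sub_exp_I_mul_le s t

theorem I_div_two_mul_cot (z : ℂ) (hz : 1 - cexp (2 * I * z) ≠ 0) :
    I / 2 * cot z = (1 - cexp (2 * I * z))⁻¹ - 1 / 2 := by
  rw [cot_eq_exp_ratio]
  have hI := I_ne_zero
  have hz' : I * (1 - cexp (2 * I * z)) ≠ 0 := mul_ne_zero hI hz
  generalize cexp (2 * I * z) = q at *
  field_simp
  ring

theorem one_sub_exp_two_pi_I_mul_ne_zero {z : ℂ} (hz : z ∈ integerComplement) :
    1 - cexp (2 * I * (Real.pi * z)) ≠ 0 := by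
  intro h
  rw [sub_eq_zero, eq_comm, Complex.exp_eq_one_iff] at h
  obtain ⟨n, hn⟩ := h
  refine hz ⟨n, ?_⟩
  have hpi : (2 * Real.pi * I : ℂ) ≠ 0 := two_pi_I_ne_zero
  refine mul_right_cancel₀ hpi ?_
  linear_combination -hn

theorem integral_one_sub_exp_mul_binetKernel {β : ℝ} (hβ0 : 0 < β) (hβ1 : β < 1) (s : ℝ) :
    I * ∫ t : ℝ, (1 - cexp (I * s * t)) * (binetKernel β t : ℂ) =
      (1 - cexp (-s) * e2pi β)⁻¹ - (1 - e2pi β)⁻¹ := by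
  have hpi : (Real.pi : ℂ) ≠ 0 := by exact_mod_cast Real.pi_ne_zero
  set w : ℂ := β + I * (s / (2 * Real.pi) : ℝ) with hw_def
  have hw : w ∈ integerComplement := ofReal_add_mem_integerComplement hβ0 hβ1 _
  have hβ : (β : ℂ) ∈ integerComplement := by
    simpa using ofReal_add_mem_integerComplement hβ0 hβ1 0
  have hint := integrable_one_sub_exp_mul_binetKernel hβ0 hβ1 s
  rw [← intervalIntegral.integral_Iic_add_Ioi (b := 0) hint.integrableOn hint.integrableOn]
  have hA := hasSum_integral_one_sub_exp (c := 1 - β) (by linarith) s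
  have hB := hasSum_integral_one_sub_exp hβ0 (-s)
  have hIoi : ∫ t in Ioi (0 : ℝ), (1 - cexp (I * s * t)) * (binetKernel β t : ℂ) =
      ∫ t in Ioi (0 : ℝ), (1 - cexp (I * s * t)) * ((Real.exp (-(2 * Real.pi * (1 - β)) * t) /
        (1 - Real.exp (-(2 * Real.pi) * t)) : ℝ) : ℂ) := by
    simp only [binetKernel_eq]
  have hIic : ∫ t in Iic (0 : ℝ), (1 - cexp (I * s * t)) * (binetKernel β t : ℂ) =
      -∫ t in Ioi (0 : ℝ), (1 - cexp (I * (-s : ℝ) * t)) * ((Real.exp (-(2 * Real.pi * β) * t) /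
        (1 - Real.exp (-(2 * Real.pi) * t)) : ℝ) : ℂ) := by
    rw [← integral_neg]
    have h := integral_comp_neg_Ioi 0 (fun t : ℝ => (1 - cexp (I * s * t)) * (binetKernel β t : ℂ))
    rw [neg_zero] at h
    rw [← h]
    congr 1 with t
    rw [binetKernel_neg, binetKernel_eq, sub_sub_cancel]
    push_cast
    ring_nf
  rw [← hIoi] at hA
  rw [← neg_eq_iff_eq_neg] at hIic
  rw [← hIic] at hB
  have hC := ((summable_cotTerm hw).hasSum.sub (summable_cotTerm hβ).hasSum).mul_left
    (2 * Real.pi : ℂ)⁻¹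
  rw [← cot_series_rep' hw, ← cot_series_rep' hβ] at hC
  have hB' := (hasSum_nat_add_iff' 1).mpr hB
  have hw' : (2 * Real.pi * w : ℂ) = 2 * Real.pi * β + I * s := by
    simp only [hw_def]; push_cast; field_simp
  have hterms : (fun n : ℕ => (2 * Real.pi : ℂ)⁻¹ * (cotTerm w n - cotTerm β n)) = fun n : ℕ =>
      ((2 * Real.pi * (n + (1 - β : ℝ)) : ℂ)⁻¹ - (2 * Real.pi * (n + (1 - β : ℝ)) - I * s)⁻¹) -
      ((2 * Real.pi * ((n + 1 : ℕ) + β) : ℂ)⁻¹ -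
        (2 * Real.pi * ((n + 1 : ℕ) + β) - I * (-s : ℝ))⁻¹) := by
    ext n
    have e1 : (2 * Real.pi * (n + (1 - β : ℝ)) : ℂ) = -(2 * Real.pi * (β - (n + 1))) := by
      push_cast; ring
    have e2 : (2 * Real.pi * (n + (1 - β : ℝ)) - I * s : ℂ) = -(2 * Real.pi * (w - (n + 1))) := by
      rw [mul_sub, hw']; push_cast; ring
    have e3 : (2 * Real.pi * ((n + 1 : ℕ) + β) : ℂ) = 2 * Real.pi * (β + (n + 1)) := by
      push_cast; ring
    have e4 : (2 * Real.pi * ((n + 1 : ℕ) + β) - I * (-s : ℝ) : ℂ) =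
        2 * Real.pi * (w + (n + 1)) := by
      rw [mul_add _ w, hw']; push_cast; ring
    rw [e2, e4, e1, e3, inv_neg, inv_neg]
    simp only [cotTerm, mul_inv]
    ring
  have e0 : (2 * Real.pi * ((0 : ℕ) + β) - I * (-s : ℝ) : ℂ) = 2 * Real.pi * w := by
    rw [hw']; push_cast; ring
  rw [hterms] at hC
  have huniq := (hA.sub hB').unique hC
  rw [Finset.sum_range_one, e0, Nat.cast_zero, zero_add, mul_inv, mul_inv _ w] at huniq
  have hcotw := I_div_two_mul_cot _ (one_sub_exp_two_pi_I_mul_ne_zero hw)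
  have hcotβ := I_div_two_mul_cot _ (one_sub_exp_two_pi_I_mul_ne_zero hβ)
  have hew : cexp (2 * I * (Real.pi * w)) = cexp (-s) * e2pi β := by
    rw [e2pi, ← Complex.exp_add]
    congr 1
    linear_combination I * hw' + s * I_sq
  have heβ : cexp (2 * I * (Real.pi * β)) = e2pi β := by rw [e2pi]; ring_nf
  rw [hew] at hcotw
  rw [heβ] at hcotβ
  have hinv : (2 * Real.pi : ℂ)⁻¹ * Real.pi = 1 / 2 := by field_simp
  linear_combination I * huniq + hcotw - hcotβ +
    I * (cot (Real.pi * w) - cot (Real.pi * β)) * hinv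

theorem integrable_prod_one_sub_exp_mul_binetKernel {x β : ℝ} (hx : 0 < x) (hβ0 : 0 < β)
    (hβ1 : β < 1) :
    Integrable (Function.uncurry fun s t : ℝ =>
      cexp (-(x : ℂ) * s) * ((1 - cexp (I * s * t)) * (binetKernel β t : ℂ)))
      ((volume.restrict (Ioi 0)).prod volume) := by
  refine Integrable.mono' ((integrableOn_mul_exp_neg_mul_Ioi hx).norm.mul_prod
    (integrable_mul_binetKernel hβ0 hβ1).norm) ?_ ?_
  · have := measurable_binetKernel β
    exact Measurable.aestronglyMeasurable (by unfold Function.uncurry; fun_prop)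
  · filter_upwards with p
    have h := norm_one_sub_exp_I_mul_le p.1 p.2
    have hexp : ‖cexp (-(x : ℂ) * p.1)‖ = Real.exp (-x * p.1) := by simp [Complex.norm_exp]
    simp only [Function.uncurry]
    rw [norm_mul, norm_mul, norm_real, hexp, norm_mul, norm_mul,
      Real.norm_of_nonneg (Real.exp_pos _).le, Real.norm_eq_abs p.1, Real.norm_eq_abs p.2]
    calc Real.exp (-x * p.1) * (‖1 - cexp (I * p.1 * p.2)‖ * ‖binetKernel β p.2‖)
        ≤ Real.exp (-x * p.1) * ((|p.1| * |p.2|) * ‖binetKernel β p.2‖) := by gcongr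
      _ = _ := by ring

theorem integral_exp_neg_mul_one_sub_exp {x : ℝ} (hx : 0 < x) (t : ℝ) :
    ∫ s in Ioi (0 : ℝ), cexp (-(x : ℂ) * s) * (1 - cexp (I * s * t)) =
      (I * t - x)⁻¹ + (x : ℂ)⁻¹ := by
  have h1 : (-(x : ℂ)).re < 0 := by simpa using hx
  have h2 : (I * t - x : ℂ).re < 0 := by simpa using hx
  have hfun : (fun s : ℝ => cexp (-(x : ℂ) * s) * (1 - cexp (I * s * t))) =
      fun s : ℝ => cexp (-(x : ℂ) * s) - cexp ((I * t - x) * s) := by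
    ext s
    rw [mul_sub, mul_one, ← Complex.exp_add]
    ring_nf
  rw [hfun, integral_sub (integrableOn_exp_mul_complex_Ioi h1 0)
    (integrableOn_exp_mul_complex_Ioi h2 0), integral_exp_mul_complex_Ioi h1,
    integral_exp_mul_complex_Ioi h2]
  simp [div_eq_mul_inv, add_comm]

/-- A Binet-type integral representation for `ψ_β(x) = ∫₀^∞ e^{-xt}/(1 - e^{-t}e^{2πiβ}) dt`:
for real `x > 0` and `0 < β < 1`,
`ψ_β(x) = 1/(2x) - (i/(2πx))(ψ(β) - ψ(1-β)) + i ∫_{-∞}^∞ (1/(it-x) + 1/x) e^{2πβt}/(e^{2πt}-1) dt`,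
and both integrals converge absolutely. -/
theorem psiBeta_binet (x β : ℝ) (hx : 0 < x) (hβ0 : 0 < β) (hβ1 : β < 1) :
    IntegrableOn
      (fun t : ℝ => Complex.exp (-(x : ℂ) * t) / (1 - Complex.exp (-(t : ℂ)) * e2pi β))
      (Set.Ioi 0) ∧
    Integrable
      (fun t : ℝ => ((Complex.I * t - x)⁻¹ + (x : ℂ)⁻¹) *
        ((Real.exp (2 * Real.pi * β * t) / (Real.exp (2 * Real.pi * t) - 1) : ℝ) : ℂ)) ∧
    ∫ t in Set.Ioi (0 : ℝ),
        Complex.exp (-(x : ℂ) * t) / (1 - Complex.exp (-(t : ℂ)) * e2pi β)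
      = 1 / (2 * x) -
          Complex.I / (2 * Real.pi * x) * (_root_.digamma β - _root_.digamma (1 - β)) +
        Complex.I * ∫ t : ℝ,
          ((Complex.I * t - x)⁻¹ + (x : ℂ)⁻¹) *
            ((Real.exp (2 * Real.pi * β * t) / (Real.exp (2 * Real.pi * t) - 1) : ℝ) : ℂ) := by
  have hprod := integrable_prod_one_sub_exp_mul_binetKernel hx hβ0 hβ1
  have hinner (t : ℝ) : ∫ s in Ioi (0 : ℝ),
      cexp (-(x : ℂ) * s) * ((1 - cexp (I * s * t)) * (binetKernel β t : ℂ)) =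
      ((I * t - x)⁻¹ + (x : ℂ)⁻¹) * (binetKernel β t : ℂ) := by
    simp only [← mul_assoc]
    rw [integral_mul_const, integral_exp_neg_mul_one_sub_exp hx]
  have houter (s : ℝ) : cexp (-(x : ℂ) * s) / (1 - cexp (-(s : ℂ)) * e2pi β) =
      cexp (-(x : ℂ) * s) * (1 - e2pi β)⁻¹ + I * ∫ t : ℝ,
        cexp (-(x : ℂ) * s) * ((1 - cexp (I * s * t)) * (binetKernel β t : ℂ)) := by
    rw [integral_const_mul, mul_left_comm, integral_one_sub_exp_mul_binetKernel hβ0 hβ1]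
    ring
  have hre : (-(x : ℂ)).re < 0 := by simpa using hx
  have hint1 := (integrableOn_exp_mul_complex_Ioi hre 0).mul_const (1 - e2pi β)⁻¹
  have hint2 := hprod.integral_prod_left.const_mul I
  have hint3 := hprod.integral_prod_right
  have hswap := integral_integral_swap hprod
  simp only [Function.uncurry] at hint2 hint3
  simp only [hinner] at hint3 hswap
  refine ⟨?_, hint3, ?_⟩
  · simp only [houter]
    exact hint1.add hint2
  · have hβ : (β : ℂ) ∈ integerComplement := by
      simpa using ofReal_add_mem_integerComplement hβ0 hβ1 0
    have hcot := I_div_two_mul_cot _ (one_sub_exp_two_pi_I_mul_ne_zero hβ)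
    have he : cexp (2 * I * (Real.pi * β)) = e2pi β := by rw [e2pi]; ring_nf
    rw [he] at hcot
    have hpi : (Real.pi : ℂ) ≠ 0 := by exact_mod_cast Real.pi_ne_zero
    have hx' : (x : ℂ) ≠ 0 := by exact_mod_cast hx.ne'
    simp only [houter]
    rw [integral_add hint1 hint2, integral_mul_const, integral_const_mul, hswap,
      integral_exp_mul_complex_Ioi hre, digamma_sub_digamma_one_sub hβ]
    have hmain : -cexp (-(x : ℂ) * (0 : ℝ)) / -x * (1 - e2pi β)⁻¹ =
        1 / (2 * x) - I / (2 * Real.pi * x) * -(Real.pi * cot (Real.pi * β)) := by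
      rw [eq_add_of_sub_eq hcot.symm]
      simp only [ofReal_zero, mul_zero, Complex.exp_zero]
      generalize cot (Real.pi * β) = C
      field_simp
      ring
    rw [hmain]
    rfl

end
end
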